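/- For every state ρ on C^d ⊗ C^d (d ≥ 2), the entropic entanglement parameter satisfies M(ρ) ≤ log₂ d + (1 − 1/d)·log₂(d + 1) − S(ρ). -/

import Mathlib

open Matrix Kronecker BigOperators ComplexOrder

noncomputable section

namespace EEP

/-- `-(x * log₂ x)`; note `Real.logb 2 0 = 0`, giving the convention `0·log₂ 0 = 0`. -/
def negMulLog2 (x : ℝ) : ℝ := -(x * Real.logb 2 x)

/-- Shannon entropy (base 2) of a finite family of reals. -/
def shannon {n : Type*} [Fintype n] (p : n → ℝ) : ℝ := ∑ i, negMulLog2 (p i)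

/-- A quantum state: positive semidefinite (hence Hermitian) matrix with trace 1. -/
def IsState {n : Type*} [Fintype n] [DecidableEq n] (ρ : Matrix n n ℂ) : Prop :=
  ρ.PosSemidef ∧ ρ.trace = 1

/-- A rank-one orthogonal projection matrix. -/
def IsRankOneProj {n : Type*} [Fintype n] [DecidableEq n] (P : Matrix n n ℂ) : Prop :=
  P.IsHermitian ∧ P * P = P ∧ P.rank = 1

/-- A von Neumann measurement on `C^d ⊗ C^d`: a family of `d²` rank-one orthogonal
projections, mutually orthogonal, summing to the identity. -/
def IsMeasurement {d : ℕ} (P : Fin (d^2) → Matrix (Fin d × Fin d) (Fin d × Fin d) ℂ) : Prop :=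
  (∀ i, IsRankOneProj (P i)) ∧ (∀ i j, i ≠ j → P i * P j = 0) ∧ (∑ i, P i) = 1

/-- Klein entropy: Shannon entropy of the outcome distribution `pᵢ = Tr(ρ Pᵢ)`. -/
def kleinEntropy {d : ℕ} (ρ : Matrix (Fin d × Fin d) (Fin d × Fin d) ℂ)
    (P : Fin (d^2) → Matrix (Fin d × Fin d) (Fin d × Fin d) ℂ) : ℝ :=
  shannon (fun i => (ρ * P i).trace.re)

/-- A product state: Kronecker product of two states on `C^d`. -/
def IsProductState {d : ℕ} (δ : Matrix (Fin d × Fin d) (Fin d × Fin d) ℂ) : Prop :=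
  ∃ σA σB : Matrix (Fin d) (Fin d) ℂ, IsState σA ∧ IsState σB ∧ δ = σA ⊗ₖ σB

/-- Infimum of the Klein entropy over product states, for a fixed measurement. -/
def infProd {d : ℕ} (P : Fin (d^2) → Matrix (Fin d × Fin d) (Fin d × Fin d) ℂ) : ℝ :=
  sInf {x : ℝ | ∃ δ, IsProductState δ ∧ x = kleinEntropy δ P}

/-- The entropic entanglement parameter
`M(ρ) = sup_P ( inf_{δ product} H(δ,P) − H(ρ,P) )`. -/
def eep {d : ℕ} (ρ : Matrix (Fin d × Fin d) (Fin d × Fin d) ℂ) : ℝ :=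
  sSup {x : ℝ | ∃ P, IsMeasurement P ∧ x = infProd P - kleinEntropy ρ P}

/-- A separable state: finite convex combination of product states. -/
def IsSeparable {d : ℕ} (ρ : Matrix (Fin d × Fin d) (Fin d × Fin d) ℂ) : Prop :=
  ∃ (m : ℕ) (p : Fin m → ℝ) (δ : Fin m → Matrix (Fin d × Fin d) (Fin d × Fin d) ℂ),
    (∀ i, 0 ≤ p i) ∧ (∑ i, p i) = 1 ∧ (∀ i, IsProductState (δ i)) ∧
    ρ = ∑ i, (p i : ℂ) • δ i

/-- Rank-one projection `|v⟩⟨v|` onto a vector `v`. -/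
def projVec {n : Type*} (v : n → ℂ) : Matrix n n ℂ := Matrix.vecMulVec v (star v)

/-- Coefficient matrix `A` of a vector `ψ ∈ C^d ⊗ C^d`, `A i j = ψ (i,j)`. -/
def coeffMat {d : ℕ} (ψ : Fin d × Fin d → ℂ) : Matrix (Fin d) (Fin d) ℂ :=
  Matrix.of fun i j => ψ (i, j)

/-- The squared Schmidt coefficients of `ψ`: the eigenvalues of `A Aᴴ`
where `A` is the coefficient matrix of `ψ`. -/
def schmidtSq {d : ℕ} (ψ : Fin d × Fin d → ℂ) : Fin d → ℝ :=
  (Matrix.isHermitian_mul_conjTranspose_self (coeffMat ψ)).eigenvalues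

/-- Largest squared Schmidt coefficient (square of the largest singular value of `A`). -/
def maxSchmidtSq {d : ℕ} (ψ : Fin d × Fin d → ℂ) : ℝ := ⨆ i, schmidtSq ψ i

/-- A unit vector. -/
def IsUnitVec {n : Type*} [Fintype n] (ψ : n → ℂ) : Prop := (∑ p, Complex.normSq (ψ p)) = 1

/-- A maximally entangled unit vector: all squared Schmidt coefficients equal `1/d`. -/
def IsMaxEntVec {d : ℕ} (ψ : Fin d × Fin d → ℂ) : Prop :=
  IsUnitVec ψ ∧ ∀ i, schmidtSq ψ i = 1 / d

/-- A von Neumann measurement in a maximally entangled basis. -/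
def IsMaxEntMeasurement {d : ℕ}
    (P : Fin (d^2) → Matrix (Fin d × Fin d) (Fin d × Fin d) ℂ) : Prop :=
  IsMeasurement P ∧ ∀ i, ∃ ψ, IsMaxEntVec ψ ∧ P i = projVec ψ

/-- Von Neumann entropy: Shannon entropy of the eigenvalues. -/
def vnEntropy {n : Type*} [Fintype n] [DecidableEq n] {ρ : Matrix n n ℂ}
    (h : ρ.IsHermitian) : ℝ := shannon h.eigenvalues

/-- Binary Shannon entropy. -/
def binEnt (x : ℝ) : ℝ := negMulLog2 x + negMulLog2 (1 - x)

lemma rankOne_factor {n : Type*} [Fintype n] [DecidableEq n] {P : Matrix n n ℂ}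
    (h : P.rank = 1) : ∃ u w : n → ℂ, P = vecMulVec u w := by
  unfold Matrix.rank at h
  obtain ⟨v, hv, hall⟩ := finrank_eq_one_iff'.1 h
  have hc : ∀ j : n, ∃ c : ℂ, ∀ i, P i j = c * (v : n → ℂ) i := by
    intro j
    obtain ⟨c, hc⟩ := hall ⟨P.mulVecLin (Pi.single j 1), LinearMap.mem_range_self _ _⟩
    refine ⟨c, fun i => ?_⟩
    have := congrFun (congrArg Subtype.val hc) i
    simp at this
    exact this.symm
  choose c hc using hc
  refine ⟨v, c, ?_⟩
  ext i j
  rw [hc, vecMulVec_apply, mul_comm]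

lemma proj_trace {n : Type*} [Fintype n] [DecidableEq n] {P : Matrix n n ℂ}
    (h : IsRankOneProj P) : P.trace = 1 := by
  obtain ⟨u, w, hP⟩ := rankOne_factor h.2.2
  have h0 : P ≠ 0 := by
    rintro rfl
    have := h.2.2
    simp at this
  have hsq := h.2.1
  have key : P.trace • P = P := by
    conv_rhs => rw [← hsq]
    ext i j
    rw [hP]
    simp only [Matrix.smul_apply, Matrix.trace, Matrix.diag, Matrix.mul_apply, vecMulVec_apply,
      smul_eq_mul, Finset.sum_mul]
    exact Finset.sum_congr rfl fun k _ => by ring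
  have : (P.trace - 1) • P = 0 := by rw [sub_smul, key, one_smul, sub_self]
  rcases smul_eq_zero.1 this with h1 | h1
  · exact sub_eq_zero.1 h1
  · exact absurd h1 h0

lemma proj_psd {n : Type*} [Fintype n] [DecidableEq n] {P : Matrix n n ℂ}
    (h : IsRankOneProj P) : P.PosSemidef := by
  have := Matrix.posSemidef_conjTranspose_mul_self P
  rwa [h.1.eq, h.2.1] at this

lemma trace_mul_proj_nonneg {n : Type*} [Fintype n] [DecidableEq n] {P ρ : Matrix n n ℂ}
    (h : IsRankOneProj P) (hρ : ρ.PosSemidef) : 0 ≤ (ρ * P).trace := by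
  have h1 := (hρ.mul_mul_conjTranspose_same P).trace_nonneg
  have : (ρ * P).trace = (P * ρ * Pᴴ).trace := by
    rw [h.1.eq, Matrix.trace_mul_comm (P * ρ) P, ← Matrix.mul_assoc, h.2.1, Matrix.trace_mul_comm]
  rwa [this]

lemma negMulLog2_eq (x : ℝ) : negMulLog2 x = (Real.log 2)⁻¹ * Real.negMulLog x := by
  unfold negMulLog2 Real.negMulLog Real.logb
  ring

lemma concave_negMulLog2 : ConcaveOn ℝ (Set.Ici 0) negMulLog2 := by
  have h := Real.concaveOn_negMulLog.smul (c := (Real.log 2)⁻¹)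
    (inv_nonneg.2 (Real.log_nonneg (by norm_num)))
  have e : negMulLog2 = fun x => (Real.log 2)⁻¹ • Real.negMulLog x := by
    funext x
    rw [negMulLog2_eq, smul_eq_mul]
  rw [e]
  exact h

lemma prob_sum {d : ℕ} {P : Fin (d^2) → Matrix (Fin d × Fin d) (Fin d × Fin d) ℂ}
    (hP : IsMeasurement P) {ρ : Matrix (Fin d × Fin d) (Fin d × Fin d) ℂ} (hρ : IsState ρ) :
    ∑ i, (ρ * P i).trace.re = 1 := by
  rw [← Complex.re_sum, ← Matrix.trace_sum, ← Matrix.mul_sum, hP.2.2, Matrix.mul_one, hρ.2]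
  simp

lemma klein_ge {d : ℕ} {P : Fin (d^2) → Matrix (Fin d × Fin d) (Fin d × Fin d) ℂ}
    (hP : IsMeasurement P) {ρ : Matrix (Fin d × Fin d) (Fin d × Fin d) ℂ} (hρ : IsState ρ) :
    vnEntropy hρ.1.1 ≤ kleinEntropy ρ P := by
  set U : Matrix (Fin d × Fin d) (Fin d × Fin d) ℂ := hρ.1.1.eigenvectorUnitary.1 with hU
  have hUU : Uᴴ * U = 1 := by
    exact Unitary.coe_star_mul_self hρ.1.1.eigenvectorUnitary
  have hUU' : U * Uᴴ = 1 := by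
    exact Unitary.coe_mul_star_self hρ.1.1.eigenvectorUnitary
  set l := hρ.1.1.eigenvalues with hl
  have hspec : ρ = U * diagonal (fun k => (l k : ℂ)) * Uᴴ := by
    conv_lhs => rw [hρ.1.1.spectral_theorem, Unitary.conjStarAlgAut_apply]
    rfl
  have hl0 : ∀ k, 0 ≤ l k := hρ.1.eigenvalues_nonneg
  set M : Fin d × Fin d → Fin (d^2) → ℝ := fun k i => ((Uᴴ * P i * U) k k).re with hM
  have hM0 : ∀ k i, 0 ≤ M k i := fun k i =>
    (Complex.le_def.1 ((proj_psd (hP.1 i)).conjTranspose_mul_mul_same U).diag_nonneg).1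
  have hMi : ∀ k, ∑ i, M k i = 1 := by
    intro k
    simp only [hM]
    rw [← Complex.re_sum, ← Matrix.sum_apply, ← Matrix.sum_mul, ← Matrix.mul_sum, hP.2.2,
      Matrix.mul_one, hUU]
    simp
  have hMk : ∀ i, ∑ k, M k i = 1 := by
    intro i
    have : (Uᴴ * P i * U).trace = 1 := by
      rw [Matrix.trace_mul_comm, ← Matrix.mul_assoc, hUU', Matrix.one_mul, proj_trace (hP.1 i)]
    simp only [hM]
    rw [← Complex.re_sum]
    change (Uᴴ * P i * U).trace.re = 1
    rw [this]; simp
  have hp : ∀ i, (ρ * P i).trace.re = ∑ k, M k i • l k := by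
    intro i
    have : (ρ * P i).trace = (diagonal (fun k => (l k : ℂ)) * (Uᴴ * P i * U)).trace := by
      conv_lhs => rw [hspec]
      rw [Matrix.mul_assoc, Matrix.mul_assoc, Matrix.trace_mul_comm]
      simp only [Matrix.mul_assoc]
    rw [this]
    simp only [Matrix.trace, Matrix.diag, Matrix.diagonal_mul, Complex.re_sum,
      Complex.re_ofReal_mul, hM, smul_eq_mul]
    exact Finset.sum_congr rfl fun k _ => mul_comm _ _
  unfold vnEntropy kleinEntropy shannon
  calc ∑ k, negMulLog2 (l k) = ∑ k, ∑ i, M k i * negMulLog2 (l k) := by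
        refine Finset.sum_congr rfl fun k _ => ?_
        rw [← Finset.sum_mul, hMi, one_mul]
    _ = ∑ i, ∑ k, M k i * negMulLog2 (l k) := Finset.sum_comm
    _ ≤ _ := by
        refine Finset.sum_le_sum fun i _ => ?_
        beta_reduce
        rw [hp]
        exact concave_negMulLog2.le_map_sum (fun k _ => hM0 k i) (hMk i) (fun k _ => hl0 k)

lemma klein_nonneg {d : ℕ} {P : Fin (d^2) → Matrix (Fin d × Fin d) (Fin d × Fin d) ℂ}
    (hP : IsMeasurement P) {ρ : Matrix (Fin d × Fin d) (Fin d × Fin d) ℂ} (hρ : IsState ρ) :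
    0 ≤ kleinEntropy ρ P := by
  have h0 : ∀ i, 0 ≤ (ρ * P i).trace.re := fun i =>
    (Complex.le_def.1 (trace_mul_proj_nonneg (hP.1 i) hρ.1)).1
  unfold kleinEntropy shannon
  refine Finset.sum_nonneg fun i _ => ?_
  rw [negMulLog2_eq]
  refine mul_nonneg (inv_nonneg.2 (Real.log_nonneg (by norm_num))) ?_
  refine Real.negMulLog_nonneg (h0 i) ?_
  rw [← prob_sum hP hρ]
  exact Finset.single_le_sum (f := fun i => (ρ * P i).trace.re) (fun i _ => h0 i)
    (Finset.mem_univ i)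

lemma gibbs (p q : ℝ) (hp : 0 ≤ p) (hq : 0 < q) :
    negMulLog2 p ≤ p * -Real.logb 2 q + (q - p) / Real.log 2 := by
  have h2 : 0 < Real.log 2 := Real.log_pos (by norm_num)
  have key : -(p * Real.log p) ≤ -(p * Real.log q) + (q - p) := by
    rcases hp.eq_or_lt with rfl | hp
    · simp; exact hq.le
    · have := Real.log_le_sub_one_of_pos (div_pos hq hp)
      rw [Real.log_div hq.ne' hp.ne'] at this
      have h := mul_le_mul_of_nonneg_left this hp.le
      have e : p * (q / p - 1) = q - p := by field_simp
      rw [e] at h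
      linarith
  unfold negMulLog2 Real.logb
  have := div_le_div_of_nonneg_right key h2.le
  calc _ = -(p * Real.log p) / Real.log 2 := by ring
    _ ≤ _ := this
    _ = _ := by ring

lemma entropy_bound {d : ℕ} (hd : 2 ≤ d) (p : Fin (d^2) → ℝ) (hp : ∀ i, 0 ≤ p i)
    (hs : ∑ i, p i = 1) (i0 : Fin (d^2)) (h0 : 1 / (d:ℝ) ≤ p i0) :
    shannon p ≤ Real.logb 2 d + (1 - 1/(d:ℝ)) * Real.logb 2 ((d:ℝ) + 1) := by
  have hd' : (2:ℝ) ≤ d := by exact_mod_cast hd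
  have hd0 : (0:ℝ) < d := by linarith
  set q : Fin (d^2) → ℝ := fun i => if i = i0 then 1/(d:ℝ) else 1/((d:ℝ)*(d+1)) with hq
  have hq0 : ∀ i, 0 < q i := by
    intro i; simp only [hq]; split_ifs <;> positivity
  have hqs : ∑ i, q i = 1 := by
    have : ∀ i, q i = 1/((d:ℝ)*(d+1)) + if i = i0 then 1/(d:ℝ) - 1/((d:ℝ)*(d+1)) else 0 := by
      intro i; simp only [hq]; split_ifs <;> ring
    simp only [this, Finset.sum_add_distrib, Finset.sum_ite_eq', Finset.mem_univ, if_true]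
    simp
    field_simp
    ring
  have hlq : ∀ i, -Real.logb 2 (q i) = Real.logb 2 d + Real.logb 2 ((d:ℝ)+1)
      - if i = i0 then Real.logb 2 ((d:ℝ)+1) else 0 := by
    intro i; simp only [hq]; split_ifs
    · rw [one_div, Real.logb_inv]; ring
    · rw [one_div, Real.logb_inv, Real.logb_mul hd0.ne' (by positivity)]; ring
  have hL : 0 ≤ Real.logb 2 ((d:ℝ)+1) := Real.logb_nonneg (by norm_num) (by linarith)
  calc shannon p ≤ ∑ i, (p i * -Real.logb 2 (q i) + (q i - p i) / Real.log 2) :=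
        Finset.sum_le_sum fun i _ => gibbs _ _ (hp i) (hq0 i)
    _ = Real.logb 2 d + Real.logb 2 ((d:ℝ)+1) - p i0 * Real.logb 2 ((d:ℝ)+1) := by
        rw [Finset.sum_add_distrib, ← Finset.sum_div, Finset.sum_sub_distrib, hqs, hs]
        simp only [hlq, mul_sub, Finset.sum_sub_distrib, ← Finset.sum_mul, hs, mul_ite, mul_zero,
          Finset.sum_ite_eq', Finset.mem_univ, if_true]
        ring
    _ ≤ _ := by nlinarith [mul_le_mul_of_nonneg_right h0 hL]

lemma product_isState {d : ℕ} {δ : Matrix (Fin d × Fin d) (Fin d × Fin d) ℂ}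
    (h : IsProductState δ) : IsState δ := by
  obtain ⟨A, B, hA, hB, rfl⟩ := h
  exact ⟨hA.1.kronecker hB.1, by rw [Matrix.trace_kronecker, hA.2, hB.2, one_mul]⟩

lemma exists_product {d : ℕ} (hd : 2 ≤ d) {P : Matrix (Fin d × Fin d) (Fin d × Fin d) ℂ}
    (hP : IsRankOneProj P) : ∃ δ, IsProductState δ ∧ 1 / (d:ℝ) ≤ (δ * P).trace.re := by
  have hd0 : (0:ℝ) < d := by exact_mod_cast (by omega : 0 < d)
  set B : Fin d → Matrix (Fin d) (Fin d) ℂ := fun a => P.submatrix (fun j => (a, j)) (fun j => (a, j))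
    with hB
  have hBpsd : ∀ a, (B a).PosSemidef := fun a => (proj_psd hP).submatrix _
  have htr : ∑ a, (B a).trace.re = 1 := by
    have := congrArg Complex.re (proj_trace hP)
    rw [Matrix.trace, Fintype.sum_prod_type, Complex.re_sum] at this
    simpa [hB, Matrix.trace] using this
  obtain ⟨a, ha⟩ : ∃ a, 1 / (d:ℝ) ≤ (B a).trace.re := by
    by_contra! hcon
    have hne : (Finset.univ : Finset (Fin d)).Nonempty := ⟨⟨0, by omega⟩, Finset.mem_univ _⟩
    have := Finset.sum_lt_sum_of_nonempty hne fun a _ => hcon a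
    rw [htr] at this
    simp [hd0.ne'] at this
  set t := (B a).trace.re with ht
  have htpos : 0 < t := lt_of_lt_of_le (by positivity) ha
  have htt : (B a).trace = (t : ℂ) := by
    have h := (Complex.le_def.1 (hBpsd a).trace_nonneg).2
    apply Complex.ext
    · simp [ht]
    · simpa using h.symm
  have htc : (t : ℂ) ≠ 0 := by exact_mod_cast htpos.ne'
  have hBB : (B a * B a).trace = (t:ℂ) * t := by
    rw [← htt]
    obtain ⟨u, w, hPu⟩ := rankOne_factor hP.2.2
    simp only [hB, hPu, Matrix.trace, Matrix.diag, Matrix.mul_apply, Matrix.submatrix_apply,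
      vecMulVec_apply, Finset.sum_mul_sum]
    exact Finset.sum_congr rfl fun i _ => Finset.sum_congr rfl fun j _ => by ring
  refine ⟨(diagonal (Pi.single a 1)) ⊗ₖ ((t:ℂ)⁻¹ • B a), ⟨_, _, ⟨?_, ?_⟩, ⟨?_, ?_⟩, rfl⟩, ?_⟩
  · refine Matrix.PosSemidef.diagonal ?_
    intro i
    by_cases h : i = a
    · subst h; simp
    · simp [h]
  · simp [Matrix.trace_diagonal]
  · refine (hBpsd a).smul ?_
    rw [← Complex.ofReal_inv]
    exact_mod_cast (inv_pos.2 htpos).le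
  · rw [Matrix.trace_smul, htt, smul_eq_mul, inv_mul_cancel₀ htc]
  · have : ((diagonal (Pi.single a (1:ℂ))) ⊗ₖ ((t:ℂ)⁻¹ • B a) * P).trace
        = (t:ℂ)⁻¹ * (B a * B a).trace := by
      simp only [Matrix.trace, Matrix.diag, Matrix.mul_apply, Fintype.sum_prod_type,
        Matrix.kroneckerMap_apply, Matrix.smul_apply, Matrix.diagonal_apply, Pi.single_apply]
      simp only [ite_mul, zero_mul, one_mul, Finset.sum_ite_eq, Finset.mem_univ, if_true,
        Finset.mul_sum, smul_eq_mul]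
      rw [Finset.sum_eq_single a]
      · refine Finset.sum_congr rfl fun j _ => ?_
        rw [Finset.sum_eq_single a]
        · simp [hB, mul_assoc]
        · intro b _ hb; simp [hb.symm]
        · simp
      · intro b _ hb; simp [hb]
      · simp
    rw [this, hBB, inv_mul_cancel_left₀ htc]
    simpa using ha

lemma exists_measurement (d : ℕ) :
    ∃ P : Fin (d^2) → Matrix (Fin d × Fin d) (Fin d × Fin d) ℂ, IsMeasurement P := by
  have e : Fin (d^2) ≃ Fin d × Fin d := (finCongr (sq d)).trans finProdFinEquiv.symm
  refine ⟨fun i => diagonal (Pi.single (e i) 1), fun i => ⟨?_, ?_, ?_⟩, fun i j hij => ?_, ?_⟩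
  · rw [Matrix.IsHermitian, Matrix.diagonal_conjTranspose]
    congr 1
    ext k
    simp [Pi.single_apply]
  · rw [Matrix.diagonal_mul_diagonal]
    congr 1
    ext k
    simp [Pi.single_apply]
  · rw [Matrix.rank_diagonal]
    simp [Pi.single_apply]
  · rw [Matrix.diagonal_mul_diagonal, ← Matrix.diagonal_zero]
    congr 1
    ext k
    simp only [Pi.single_apply]
    by_cases h : k = e i
    · subst h; simp [hij]
    · simp [h]
  · ext a b
    rw [Matrix.sum_apply, e.sum_comp (fun k => (diagonal (Pi.single k (1:ℂ)) : Matrix _ _ ℂ) a b)]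
    simp [Matrix.diagonal_apply, Matrix.one_apply, Pi.single_apply]

/-- For every state ρ on C^d ⊗ C^d (d ≥ 2),
M(ρ) ≤ log₂ d + (1 − 1/d) log₂(d+1) − S(ρ). -/
theorem stmt3 {d : ℕ} (hd : 2 ≤ d) (ρ : Matrix (Fin d × Fin d) (Fin d × Fin d) ℂ)
    (hρ : IsState ρ) :
    eep ρ ≤ Real.logb 2 d + (1 - 1/(d:ℝ)) * Real.logb 2 ((d:ℝ) + 1) - vnEntropy hρ.1.1 := by
  obtain ⟨P0, hP0⟩ := exists_measurement d
  refine csSup_le ⟨_, P0, hP0, rfl⟩ ?_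
  rintro x ⟨P, hP, rfl⟩
  have i0 : Fin (d^2) := ⟨0, by positivity⟩
  obtain ⟨δ, hδ, hov⟩ := exists_product hd (hP.1 i0)
  have h1 : infProd P ≤ kleinEntropy δ P := by
    refine csInf_le ⟨0, ?_⟩ ⟨δ, hδ, rfl⟩
    rintro y ⟨δ', hδ', rfl⟩
    exact klein_nonneg hP (product_isState hδ')
  have hst := product_isState hδ
  have h2 := entropy_bound hd (fun i => (δ * P i).trace.re)
    (fun i => (Complex.le_def.1 (trace_mul_proj_nonneg (hP.1 i) hst.1)).1)
    (prob_sum hP hst) i0 hov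
  have h3 := klein_ge hP hρ
  have h4 : kleinEntropy δ P ≤ _ := h2
  linarith

end EEP
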